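/- arXiv:2507.00340 — 4 statements merged into one kernel-verified Lean document; each statement's English description precedes it below -/
import Mathlib

section
/- Let v₁, v₂, v₃, v₄ ∈ ℂ² satisfy v₁ + v₂ + v₃ + v₄ = 0. Then for every natural number n, the following fixed-degree kinematic Jacobi identity holds: Σ_{p+q=n, p and q odd} (1/(p!·q!)) · ( [v₁,v₂]^p [v₃,v₄]^q + [v₂,v₃]^p [v₁,v₄]^q + [v₃,v₁]^p [v₂,v₄]^q ) = 0, where the sum runs over all pairs of odd positive integers p, q with p + q = n (and is empty, hence zero, unless n is even and n ≥ 2). -/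
open Finset

/-- The antisymmetric bracket `[u,v] := u₁v₂ − u₂v₁` on `ℂ²`. -/
def bkt (u v : Fin 2 → ℂ) : ℂ := u 0 * v 1 - u 1 * v 0

/-- The odd part of the binomial expansion of `(a + b) ^ n / n!`, for even `n`. -/
theorem sum_odd_pow_mul_pow_div_factorial (a b : ℂ) {n : ℕ} (hn : Even n) :
    ∑ p ∈ Finset.range (n + 1),
      (if Odd p ∧ Odd (n - p) then
        (((p.factorial * (n - p).factorial : ℕ) : ℂ))⁻¹ * (a ^ p * b ^ (n - p))
      else 0) = (n.factorial : ℂ)⁻¹ * (((a + b) ^ n - (-a + b) ^ n) / 2) := by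
  rw [add_pow, add_pow, ← Finset.sum_sub_distrib, Finset.sum_div, Finset.mul_sum]
  refine Finset.sum_congr rfl fun p hp => ?_
  have hpn : p ≤ n := by simpa [Nat.lt_succ_iff] using hp
  have hodd : Odd (n - p) ↔ Odd p := by
    rw [Nat.odd_sub hpn]
    simp [← Nat.not_even_iff_odd, hn]
  rcases Nat.even_or_odd p with h | h
  · rw [if_neg (by simp [h]), h.neg_pow]
    ring
  · rw [if_pos ⟨h, hodd.2 h⟩, h.neg_pow, Nat.cast_choose ℂ hpn]
    have hfac : (n.factorial : ℂ) ≠ 0 := mod_cast n.factorial_ne_zero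
    push_cast
    field_simp
    ring

/-- Fixed-degree kinematic Jacobi identity for the colorless chiral higher-spin
algebra: if `v₁ + v₂ + v₃ + v₄ = 0` in `ℂ²`, then for every `n`,
`Σ_{p+q=n, p,q odd} (1/(p!q!)) ([v₁,v₂]^p [v₃,v₄]^q + [v₂,v₃]^p [v₁,v₄]^q
  + [v₃,v₁]^p [v₂,v₄]^q) = 0`. -/
theorem kinematic_jacobi_fixed_degree (v₁ v₂ v₃ v₄ : Fin 2 → ℂ)
    (hcons : v₁ + v₂ + v₃ + v₄ = 0) (n : ℕ) :
    ∑ p ∈ Finset.range (n + 1),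
      (if Odd p ∧ Odd (n - p) then
        (((p.factorial * (n - p).factorial : ℕ) : ℂ))⁻¹ *
          (bkt v₁ v₂ ^ p * bkt v₃ v₄ ^ (n - p)
            + bkt v₂ v₃ ^ p * bkt v₁ v₄ ^ (n - p)
            + bkt v₃ v₁ ^ p * bkt v₂ v₄ ^ (n - p))
      else 0) = 0 := by
  rcases Nat.even_or_odd n with hn | hn
  · simp only [mul_add, ite_add_zero, Finset.sum_add_distrib,
      sum_odd_pow_mul_pow_div_factorial _ _ hn]
    have h0 : v₄ 0 = -(v₁ 0 + v₂ 0 + v₃ 0) := by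
      linear_combination (by simpa using congrFun hcons 0 : v₁ 0 + v₂ 0 + v₃ 0 + v₄ 0 = 0)
    have h1 : v₄ 1 = -(v₁ 1 + v₂ 1 + v₃ 1) := by
      linear_combination (by simpa using congrFun hcons 1 : v₁ 1 + v₂ 1 + v₃ 1 + v₄ 1 = 0)
    have e₁ : -bkt v₁ v₂ + bkt v₃ v₄ = -(bkt v₃ v₁ + bkt v₂ v₄) := by
      simp only [bkt, h0, h1]; ring
    have e₂ : -bkt v₂ v₃ + bkt v₁ v₄ = -(bkt v₁ v₂ + bkt v₃ v₄) := by
      simp only [bkt, h0, h1]; ring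
    have e₃ : -bkt v₃ v₁ + bkt v₂ v₄ = -(bkt v₂ v₃ + bkt v₁ v₄) := by
      simp only [bkt, h0, h1]; ring
    rw [e₁, e₂, e₃, hn.neg_pow, hn.neg_pow, hn.neg_pow]
    ring
  · refine Finset.sum_eq_zero fun p hp => if_neg fun ⟨hp₁, hp₂⟩ => ?_
    have hpn : p ≤ n := by simpa [Nat.lt_succ_iff] using hp
    have := hp₁.add_odd hp₂
    rw [Nat.add_sub_cancel' hpn] at this
    exact Nat.not_even_iff_odd.2 hn this
end

section
/- Let 𝒜 be an associative (not necessarily commutative) algebra over ℂ, let A, B, C ∈ 𝒜, and let v₁, v₂, v₃, v₄ ∈ ℂ² satisfy v₁ + v₂ + v₃ + v₄ = 0. Write X_{ij} := [v_i, v_j] and, for p ∈ ℕ and x, y ∈ 𝒜, define G_p(x,y) := x·y − (−1)^p · y·x (so G_p is the commutator for even p and the anticommutator for odd p). Then for every natural number n: Σ_{p+q=n} (1/(p!·q!)) · ( X₁₂^p X₃₄^q · G_q(G_p(A,B), C) + X₂₃^p X₁₄^q · G_q(G_p(B,C), A) + X₃₁^p X₂₄^q · G_q(G_p(C,A), B)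 ) = 0, where the sum runs over all pairs p, q ∈ ℕ with p + q = n. -/
open Finset

/-- `G_p(x,y) := x·y − (−1)^p·y·x`: the commutator for even `p`, the
anticommutator for odd `p`. -/
def G {𝒜 : Type*} [Ring 𝒜] [Algebra ℂ 𝒜] (p : ℕ) (x y : 𝒜) : 𝒜 :=
  x * y - ((-1 : ℂ) ^ p) • (y * x)

/-- The binomial theorem with the binomial coefficients written as factorial quotients. -/
theorem sum_range_pow_mul_pow_div_factorial {K : Type*} [Field K] [CharZero K] (x y : K) (n : ℕ) :
    ∑ p ∈ Finset.range (n + 1),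
      x ^ p * y ^ (n - p) / ((p.factorial * (n - p).factorial : ℕ) : K)
      = (x + y) ^ n / (n.factorial : K) := by
  rw [add_pow, Finset.sum_div]
  refine Finset.sum_congr rfl fun p hp => ?_
  have hpn : p ≤ n := Nat.lt_succ_iff.mp (Finset.mem_range.mp hp)
  have hp₀ : (p.factorial : K) ≠ 0 := Nat.cast_ne_zero.mpr p.factorial_ne_zero
  have hq₀ : ((n - p).factorial : K) ≠ 0 := Nat.cast_ne_zero.mpr (n - p).factorial_ne_zero
  have hn₀ : (n.factorial : K) ≠ 0 := Nat.cast_ne_zero.mpr n.factorial_ne_zero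
  rw [Nat.cast_choose K hpn, Nat.cast_mul]
  field_simp

/-- The nested graded bracket expanded into products. -/
theorem G_G_eq {𝒜 : Type*} [Ring 𝒜] [Algebra ℂ 𝒜] (p q : ℕ) (A B C : 𝒜) :
    G q (G p A B) C = A * B * C - ((-1 : ℂ) ^ p) • (B * A * C) - ((-1 : ℂ) ^ q) • (C * A * B)
      + ((-1 : ℂ) ^ p * (-1) ^ q) • (C * B * A) := by
  simp only [G, sub_mul, mul_sub, smul_sub, smul_mul_assoc, mul_smul_comm, smul_smul, mul_assoc]
  rw [mul_comm ((-1 : ℂ) ^ q)]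
  abel

/-- The exponential-type sum of nested graded brackets in a single channel. -/
theorem sum_range_smul_G_G {𝒜 : Type*} [Ring 𝒜] [Algebra ℂ 𝒜] (A B C : 𝒜) (x y : ℂ) (n : ℕ) :
    ∑ p ∈ Finset.range (n + 1),
      (x ^ p * y ^ (n - p) / ((p.factorial * (n - p).factorial : ℕ) : ℂ)) • G (n - p) (G p A B) C
      = ((x + y) ^ n / (n.factorial : ℂ)) • (A * B * C)
        - ((-x + y) ^ n / (n.factorial : ℂ)) • (B * A * C)
        - ((x + -y) ^ n / (n.factorial : ℂ)) • (C * A * B)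
        + ((-x + -y) ^ n / (n.factorial : ℂ)) • (C * B * A) := by
  simp only [← sum_range_pow_mul_pow_div_factorial, Finset.sum_smul, ← Finset.sum_sub_distrib,
    ← Finset.sum_add_distrib]
  refine Finset.sum_congr rfl fun p _ => ?_
  rw [G_G_eq, neg_pow x, neg_pow y]
  module

/-- Graded Jacobi identity of the classical chiral higher-spin
(color-kinematic) algebra: for an associative `ℂ`-algebra `𝒜`, elements
`A B C : 𝒜`, and `v₁+v₂+v₃+v₄ = 0` in `ℂ²`, writing `X_{ij} = [v_i,v_j]`,
for every `n`,
`Σ_{p+q=n} (1/(p!q!)) (X₁₂^p X₃₄^q G_q(G_p(A,B),C) + X₂₃^p X₁₄^q G_q(G_p(B,C),A)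
 + X₃₁^p X₂₄^q G_q(G_p(C,A),B)) = 0`. -/
theorem graded_jacobi_color_kinematic {𝒜 : Type*} [Ring 𝒜] [Algebra ℂ 𝒜]
    (A B C : 𝒜) (v₁ v₂ v₃ v₄ : Fin 2 → ℂ)
    (hcons : v₁ + v₂ + v₃ + v₄ = 0) (n : ℕ) :
    ∑ p ∈ Finset.range (n + 1),
      ((bkt v₁ v₂ ^ p * bkt v₃ v₄ ^ (n - p)
          / ((p.factorial * (n - p).factorial : ℕ) : ℂ)) • G (n - p) (G p A B) C
        + (bkt v₂ v₃ ^ p * bkt v₁ v₄ ^ (n - p)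
          / ((p.factorial * (n - p).factorial : ℕ) : ℂ)) • G (n - p) (G p B C) A
        + (bkt v₃ v₁ ^ p * bkt v₂ v₄ ^ (n - p)
          / ((p.factorial * (n - p).factorial : ℕ) : ℂ)) • G (n - p) (G p C A) B)
      = 0 := by
  have h4 : v₄ = -(v₁ + v₂ + v₃) := (neg_eq_of_add_eq_zero_right hcons).symm
  rw [Finset.sum_add_distrib, Finset.sum_add_distrib, sum_range_smul_G_G, sum_range_smul_G_G,
    sum_range_smul_G_G]
  have h_ABC : bkt v₂ v₃ + -bkt v₁ v₄ = bkt v₁ v₂ + bkt v₃ v₄ := by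
    simp only [h4, bkt, Pi.neg_apply, Pi.add_apply]; ring
  have h_CBA : -bkt v₂ v₃ + bkt v₁ v₄ = -bkt v₁ v₂ + -bkt v₃ v₄ := by
    simp only [h4, bkt, Pi.neg_apply, Pi.add_apply]; ring
  have h_BAC : -bkt v₃ v₁ + -bkt v₂ v₄ = -bkt v₁ v₂ + bkt v₃ v₄ := by
    simp only [h4, bkt, Pi.neg_apply, Pi.add_apply]; ring
  have h_CAB : bkt v₃ v₁ + bkt v₂ v₄ = bkt v₁ v₂ + -bkt v₃ v₄ := by
    simp only [h4, bkt, Pi.neg_apply, Pi.add_apply]; ring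
  have h_BCA : bkt v₃ v₁ + -bkt v₂ v₄ = bkt v₂ v₃ + bkt v₁ v₄ := by
    simp only [h4, bkt, Pi.neg_apply, Pi.add_apply]; ring
  have h_ACB : -bkt v₃ v₁ + bkt v₂ v₄ = -bkt v₂ v₃ + -bkt v₁ v₄ := by
    simp only [h4, bkt, Pi.neg_apply, Pi.add_apply]; ring
  rw [h_ABC, h_CBA, h_BAC, h_CAB, h_BCA, h_ACB]
  abel
end

section
/- Let Λ be the exterior algebra over ℂ of a 6-dimensional vector space with basis 1-forms ζ, u₁, u₂, ξ, t₁, t₂, and let c₁, c₂, c₃, c₄, a₁, a₂, b₁, b₂ ∈ ℂ. Define the three 2-forms ω₁ := (c₁−c₂)·2·u₁∧u₂ + 2·ζ∧(a₁u₂ − a₂u₁), Ω := (c₂−c₃)·2·(u₁−t₁)∧(u₂−t₂) − 2·(ζ−ξ)∧((a₁−b₁)(u₂−t₂) − (a₂−b₂)(u₁−t₁)), and ω₄ := (c₄−c₃)·2·t₁∧t₂ + 2·ξ∧(b₁t₂ − b₂t₁). Then ω₁ ∧ Ω ∧ ω₄ = 8·(c₄−c₁)·(a₁b₂ − a₂b₁)·ζ∧u₁∧u₂∧ξ∧t₁∧t₂.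 -/
open ExteriorAlgebra

/-- The basis 1-forms of the exterior algebra over the 6-dimensional complex
vector space `Fin 6 → ℂ`. -/
noncomputable def e (i : Fin 6) : ExteriorAlgebra ℂ (Fin 6 → ℂ) :=
  ι ℂ (Pi.single i (1 : ℂ))

theorem e_mul_self (i : Fin 6) : e i * e i = 0 :=
  ι_sq_zero _

theorem e_mul_self_assoc (i : Fin 6) (x : ExteriorAlgebra ℂ (Fin 6 → ℂ)) :
    e i * (e i * x) = 0 := by
  rw [← mul_assoc, e_mul_self, zero_mul]

theorem e_mul_swap {i j : Fin 6} (_h : j < i) : e i * e j = -(e j * e i) :=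
  eq_neg_of_add_eq_zero_left (ι_add_mul_swap _ _)

theorem e_mul_swap_assoc {i j : Fin 6} (h : j < i) (x : ExteriorAlgebra ℂ (Fin 6 → ℂ)) :
    e i * (e j * x) = -(e j * (e i * x)) := by
  rw [← mul_assoc, e_mul_swap h, neg_mul, mul_assoc]

/-- Wedge-product identity evaluating the `t`-channel bulk/defect diagram:
with basis 1-forms `ζ = e 0`, `u₁ = e 1`, `u₂ = e 2`, `ξ = e 3`, `t₁ = e 4`,
`t₂ = e 5` and
`ω₁ = (c₁−c₂)·2·u₁∧u₂ + 2·ζ∧(a₁u₂ − a₂u₁)`,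
`Ω = (c₂−c₃)·2·(u₁−t₁)∧(u₂−t₂) − 2·(ζ−ξ)∧((a₁−b₁)(u₂−t₂) − (a₂−b₂)(u₁−t₁))`,
`ω₄ = (c₄−c₃)·2·t₁∧t₂ + 2·ξ∧(b₁t₂ − b₂t₁)`, one has
`ω₁ ∧ Ω ∧ ω₄ = 8·(c₄−c₁)·(a₁b₂ − a₂b₁)·ζ∧u₁∧u₂∧ξ∧t₁∧t₂`. -/
theorem t_channel_wedge_identity (c₁ c₂ c₃ c₄ a₁ a₂ b₁ b₂ : ℂ) :
    (((c₁ - c₂) * 2) • (e 1 * e 2) + (2 : ℂ) • (e 0 * (a₁ • e 2 - a₂ • e 1))) *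
      (((c₂ - c₃) * 2) • ((e 1 - e 4) * (e 2 - e 5))
        - (2 : ℂ) • ((e 0 - e 3) * ((a₁ - b₁) • (e 2 - e 5) - (a₂ - b₂) • (e 1 - e 4)))) *
      (((c₄ - c₃) * 2) • (e 4 * e 5) + (2 : ℂ) • (e 3 * (b₁ • e 5 - b₂ • e 4)))
    = (8 * (c₄ - c₁) * (a₁ * b₂ - a₂ * b₁)) • (e 0 * e 1 * e 2 * e 3 * e 4 * e 5) := by
  simp (disch := decide) only [sub_eq_add_neg, mul_add, add_mul, smul_add, neg_mul, mul_neg,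
    smul_neg, neg_neg, neg_add_rev, smul_mul_assoc, mul_smul_comm, mul_assoc, e_mul_self,
    e_mul_self_assoc, e_mul_swap, e_mul_swap_assoc, mul_zero, smul_zero, neg_zero, add_zero,
    zero_add]
  module
end

section
/- Let v₁, v₂, v₃, v₄ ∈ ℂ² satisfy v₁ + v₂ + v₃ + v₄ = 0. Then sinh([v₁,v₂])·sinh([v₃,v₄]) + sinh([v₂,v₃])·sinh([v₁,v₄]) + sinh([v₃,v₁])·sinh([v₂,v₄]) = 0, where sinh is the complex hyperbolic sine. -/
theorem Complex.sinh_mul_sinh_sub_cyclic (a b c : ℂ) :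
    sinh a * sinh (b - c) + sinh b * sinh (c - a) + sinh c * sinh (a - b) = 0 := by
  simp only [sinh_sub]
  ring

/-- Resummed (all-derivative-orders) kinematic Jacobi identity for the
colorless Moyal star-commutator on plane waves: if `v₁+v₂+v₃+v₄ = 0` in `ℂ²`,
then `sinh([v₁,v₂])sinh([v₃,v₄]) + sinh([v₂,v₃])sinh([v₁,v₄])
 + sinh([v₃,v₁])sinh([v₂,v₄]) = 0`. -/
theorem sinh_kinematic_jacobi (v₁ v₂ v₃ v₄ : Fin 2 → ℂ)
    (hcons : v₁ + v₂ + v₃ + v₄ = 0) :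
    Complex.sinh (bkt v₁ v₂) * Complex.sinh (bkt v₃ v₄)
      + Complex.sinh (bkt v₂ v₃) * Complex.sinh (bkt v₁ v₄)
      + Complex.sinh (bkt v₃ v₁) * Complex.sinh (bkt v₂ v₄) = 0 := by
  have h (i : Fin 2) : v₄ i = -(v₁ i + v₂ i + v₃ i) := eq_neg_of_add_eq_zero_right (congrFun hcons i)
  have h₃₄ : bkt v₃ v₄ = bkt v₂ v₃ - bkt v₃ v₁ := by simp only [bkt, h]; ring
  have h₁₄ : bkt v₁ v₄ = bkt v₃ v₁ - bkt v₁ v₂ := by simp only [bkt, h]; ring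
  have h₂₄ : bkt v₂ v₄ = bkt v₁ v₂ - bkt v₂ v₃ := by simp only [bkt, h]; ring
  rw [h₃₄, h₁₄, h₂₄]
  exact Complex.sinh_mul_sinh_sub_cyclic _ _ _
end
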